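/- arXiv:1806.09077 — 4 statements merged into one kernel-verified Lean document; each statement's English description precedes it below -/
import Mathlib

section
/- Fix an integer K ≥ 2 and reals η > 0, ξ ≥ 0, γ ≥ 0 with (K−1)ηγ < 1. Let σ₁,…,σ_K ≥ 0 and let a₁,…,a_K ≥ 0 and a'₁,…,a'_K ≥ 0 be reals such that for every d = 1,…,K: a'_d ≤ η²σ_d² + (1 − 2ηξ + ηγ(K−1)) a_d + ηγ (Σ_{i<d} a'_i + Σ_{i>d} a_i). Then Σ_{d=1}^K a'_d ≤ [(1 − 2ηξ + 2ηγ(K−1)) / (1 − (K−1)ηγ)] · Σ_{d=1}^K a_d + [η² / (1 − (K−1)ηγ)] · Σ_{d=1}^K σ_d². -/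
open Finset

lemma double_sum_le {K : ℕ} (f : Fin K → ℝ) (hf : ∀ d, 0 ≤ f d)
    (s : Fin K → Finset (Fin K)) (hs : ∀ d, d ∉ s d) :
    ∑ d, ∑ i ∈ s d, f i ≤ (K - 1 : ℝ) * ∑ d, f d := by
  have h : ∀ d, ∑ i ∈ s d, f i ≤ (∑ i, f i) - f d := by
    intro d
    have h1 : ∑ i ∈ insert d (s d), f i ≤ ∑ i, f i :=
      Finset.sum_le_sum_of_subset_of_nonneg (Finset.subset_univ _) (fun i _ _ => hf i)
    rw [Finset.sum_insert (hs d)] at h1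
    linarith
  calc ∑ d, ∑ i ∈ s d, f i ≤ ∑ d, ((∑ i, f i) - f d) := Finset.sum_le_sum (fun d _ => h d)
    _ = (K - 1 : ℝ) * ∑ d, f d := by
      rw [Finset.sum_sub_distrib]
      simp
      ring

/-- The deterministic regrouping-and-summation step in the per-iteration error
recursion of stochastic alternating minimization. -/
theorem am_recursion_regroup_sum
    {K : ℕ} (hK : 2 ≤ K) (η ξ γ : ℝ) (hη : 0 < η) (hξ : 0 ≤ ξ) (hγ : 0 ≤ γ)
    (hsmall : (K - 1 : ℝ) * η * γ < 1)
    (σ a a' : Fin K → ℝ)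
    (hσ : ∀ d, 0 ≤ σ d) (ha : ∀ d, 0 ≤ a d) (ha' : ∀ d, 0 ≤ a' d)
    (hrec : ∀ d : Fin K,
      a' d ≤ η ^ 2 * (σ d) ^ 2 + (1 - 2 * η * ξ + η * γ * (K - 1)) * a d
        + η * γ * ((∑ i ∈ univ.filter (· < d), a' i) + ∑ i ∈ univ.filter (d < ·), a i)) :
    ∑ d, a' d ≤ (1 - 2 * η * ξ + 2 * η * γ * (K - 1)) / (1 - (K - 1 : ℝ) * η * γ) * ∑ d, a d
      + η ^ 2 / (1 - (K - 1 : ℝ) * η * γ) * ∑ d, (σ d) ^ 2 := by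
  have h1 := double_sum_le a' ha' (fun d => univ.filter (· < d)) (by simp)
  have h2 := double_sum_le a ha (fun d => univ.filter (d < ·)) (by simp)
  have h3 := Finset.sum_le_sum (fun d (_ : d ∈ (univ : Finset (Fin K))) => hrec d)
  simp only [Finset.sum_add_distrib, ← Finset.mul_sum] at h3
  have hg : 0 ≤ η * γ := by positivity
  have h4 := mul_le_mul_of_nonneg_left (add_le_add h1 h2) hg
  have hpos : 0 < 1 - (K - 1 : ℝ) * η * γ := by linarith
  rw [div_mul_eq_mul_div, div_mul_eq_mul_div, ← add_div, le_div_iff₀ hpos]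
  linarith
end

section
/- Let a be a real number with 1 < a < 2 and let τ, t be integers with 1 ≤ τ and τ ≤ t + 2. Then ∏_{i=τ+1}^{t+2} (1 − a/i) ≤ ((τ+1)/(t+3))^a. -/
open Finset

lemma factor_le_aux (a : ℝ) (ha : 0 < a) (x : ℝ) (hx : 0 < x) :
    1 - a / x ≤ (x / (x + 1)) ^ a := by
  have h1 : 1 - a / x ≤ Real.exp (-(a / x)) := by
    have := Real.add_one_le_exp (-(a / x))
    linarith
  refine h1.trans ?_
  rw [Real.rpow_def_of_pos (by positivity)]
  apply Real.exp_le_exp.mpr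
  have h2 : 1 - (x / (x + 1))⁻¹ ≤ Real.log (x / (x + 1)) :=
    Real.one_sub_inv_le_log_of_pos (by positivity)
  have h3 : 1 - (x / (x + 1))⁻¹ = -(1 / x) := by field_simp; ring
  rw [h3] at h2
  have h4 := mul_le_mul_of_nonneg_right h2 ha.le
  calc -(a / x) = -(1 / x) * a := by ring
    _ ≤ _ := h4

lemma prod_le_aux (a : ℝ) (ha1 : 1 < a) (ha2 : a < 2) (τ n : ℕ) (hτ : 1 ≤ τ) (h : τ ≤ n) :
    ∏ i ∈ Icc (τ + 1) n, (1 - a / (i : ℝ)) ≤ (((τ : ℝ) + 1) / ((n : ℝ) + 1)) ^ a := by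
  induction n, h using Nat.le_induction with
  | base =>
    have : ((τ : ℝ) + 1) ≠ 0 := by positivity
    simp [div_self this]
  | succ n hn ih =>
    rw [← Finset.insert_Icc_right_eq_Icc_add_one (by omega), Finset.prod_insert (by simp), mul_comm]
    have hn1 : (1 : ℝ) ≤ n := by exact_mod_cast hτ.trans hn
    have hf := factor_le_aux a (by linarith) ((n : ℝ) + 1) (by positivity)
    have h0 : 0 ≤ 1 - a / ((n : ℝ) + 1) := by
      rw [sub_nonneg, div_le_one (by positivity)]
      linarith
    push_cast
    refine (mul_le_mul ih hf h0 (by positivity)).trans_eq ?_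
    rw [← Real.mul_rpow (by positivity) (by positivity)]
    congr 1
    field_simp

/-- For `1 < a < 2`, the product `∏_{i=τ+1}^{t+2} (1 - a/i)` is bounded by
`((τ+1)/(t+3))^a`. -/
theorem prod_one_sub_div_le_rpow
    (a : ℝ) (ha1 : 1 < a) (ha2 : a < 2) (τ t : ℕ) (hτ : 1 ≤ τ) (hτt : τ ≤ t + 2) :
    ∏ i ∈ Icc (τ + 1) (t + 2), (1 - a / (i : ℝ))
      ≤ (((τ : ℝ) + 1) / ((t : ℝ) + 3)) ^ a := by
  have h := prod_le_aux a ha1 ha2 τ (t + 2) hτ hτt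
  have e : (((t + 2 : ℕ) : ℝ) + 1) = (t : ℝ) + 3 := by push_cast; ring
  rwa [e] at h
end

section
/- Let A > 0 be a real number and t ≥ 0 an integer. Then Σ_{i=2}^{t+2} (9/4)/(A² i²) · ((i+1)/(t+3))^{3/2} ≤ 9 / (A²(t+3)). -/
open Finset

lemma aux_rpow (x : ℝ) (hx : 0 < x) : x ^ (3 / 2 : ℝ) = x * √x := by
  rw [Real.sqrt_eq_rpow, show (3 / 2 : ℝ) = 1 + 1 / 2 by norm_num, Real.rpow_add hx, Real.rpow_one]

lemma aux_step (x : ℝ) (hx : 3 ≤ x) : (x + 1) * √(x + 1) / x ^ 2 ≤ 4 * √(x + 1) - 4 * √x := by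
  have hb : 0 < √(x + 1) := Real.sqrt_pos.2 (by linarith)
  have hb2 : √(x + 1) ^ 2 = x + 1 := Real.sq_sqrt (by linarith)
  have ha2 : √x ^ 2 = x := Real.sq_sqrt (by linarith)
  have h1 : (x + 1) * √(x + 1) / x ^ 2 ≤ 2 / √(x + 1) := by
    rw [div_le_div_iff₀ (by positivity) hb]
    nlinarith
  have h2 : 2 / √(x + 1) ≤ 4 * √(x + 1) - 4 * √x := by
    rw [div_le_iff₀ hb]
    nlinarith [sq_nonneg (√(x + 1) - √x)]
  linarith

lemma aux_sum (t : ℕ) :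
    ∑ i ∈ Icc 2 (t + 2), ((i : ℝ) + 1) * √((i : ℝ) + 1) / (i : ℝ) ^ 2 ≤ 4 * √((t : ℝ) + 3) := by
  induction t with
  | zero =>
    simp
    norm_num
    nlinarith [Real.sqrt_nonneg 3]
  | succ t ih =>
    rw [show t + 1 + 2 = (t + 2) + 1 by ring, Finset.sum_Icc_succ_top (by omega)]
    have h := aux_step ((t : ℝ) + 3) (by linarith [Nat.cast_nonneg (α := ℝ) t])
    push_cast
    rw [show (t : ℝ) + 2 + 1 = t + 3 by ring, show (t : ℝ) + 1 + 3 = t + 3 + 1 by ring]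
    linarith

/-- Bound on the accumulated noise term in the unrolled error recursion. -/
theorem accumulated_noise_bound (A : ℝ) (hA : 0 < A) (t : ℕ) :
    ∑ i ∈ Icc 2 (t + 2),
        (9 / 4) / (A ^ 2 * (i : ℝ) ^ 2) * ((((i : ℝ) + 1) / ((t : ℝ) + 3)) ^ (3 / 2 : ℝ))
      ≤ 9 / (A ^ 2 * ((t : ℝ) + 3)) := by
  have hn : (0 : ℝ) < (t : ℝ) + 3 := by positivity
  have hs : 0 < √((t : ℝ) + 3) := Real.sqrt_pos.2 hn
  have key : ∑ i ∈ Icc 2 (t + 2),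
        (9 / 4) / (A ^ 2 * (i : ℝ) ^ 2) * ((((i : ℝ) + 1) / ((t : ℝ) + 3)) ^ (3 / 2 : ℝ))
      = (9 / 4) / (A ^ 2 * (((t : ℝ) + 3) * √((t : ℝ) + 3))) *
        ∑ i ∈ Icc 2 (t + 2), ((i : ℝ) + 1) * √((i : ℝ) + 1) / (i : ℝ) ^ 2 := by
    rw [Finset.mul_sum]
    refine Finset.sum_congr rfl fun i hi => ?_
    have hi0 : (0 : ℝ) < i := by
      have := (Finset.mem_Icc.1 hi).1
      exact_mod_cast (by omega : 0 < i)
    rw [Real.div_rpow (by positivity) hn.le, aux_rpow _ hn, aux_rpow _ (by positivity)]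
    field_simp
  rw [key]
  refine (mul_le_mul_of_nonneg_left (aux_sum t) (by positivity)).trans (le_of_eq ?_)
  field_simp
  try norm_num
end

section
/- Let A > 0, B ≥ 0, σ² ≥ 0 be reals and let (a_t)_{t≥0} be a sequence of nonnegative reals such that for every t ≥ 0: a_{t+1} ≤ (1 − (3/2)/(t+2)) · a_t + σ² · (9/4)/(A(t+2)(A(t+2)+B)). Then for every t ≥ 0: a_{t+1} ≤ a_0 · (2/(t+3))^{3/2} + 9σ² / (A²(t+3)). -/
/-- Deterministic core of the final convergence theorem: the recursion
`a_{t+1} ≤ (1 - (3/2)/(t+2)) a_t + σ² (9/4)/(A(t+2)(A(t+2)+B))` yields an `O(1/t)` bound. -/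
theorem final_convergence_recursion
    (A B σ2 : ℝ) (hA : 0 < A) (hB : 0 ≤ B) (hσ2 : 0 ≤ σ2)
    (a : ℕ → ℝ) (ha : ∀ t, 0 ≤ a t)
    (hrec : ∀ t : ℕ, a (t + 1) ≤ (1 - (3 / 2) / ((t : ℝ) + 2)) * a t
      + σ2 * ((9 / 4) / (A * ((t : ℝ) + 2) * (A * ((t : ℝ) + 2) + B)))) :
    ∀ t : ℕ, a (t + 1) ≤ a 0 * (2 / ((t : ℝ) + 3)) ^ (3 / 2 : ℝ)
      + 9 * σ2 / (A ^ 2 * ((t : ℝ) + 3)) := by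
  have key : ∀ t : ℕ, a t ≤ a 0 * (2 / ((t : ℝ) + 2)) ^ (3 / 2 : ℝ)
      + 9 * σ2 / A ^ 2 / ((t : ℝ) + 2) := by
    intro t
    induction t with
    | zero =>
      have h : (2 / (((0 : ℕ) : ℝ) + 2)) = 1 := by norm_num
      rw [h, Real.one_rpow, mul_one]
      have : 0 ≤ 9 * σ2 / A ^ 2 / (((0 : ℕ) : ℝ) + 2) := by positivity
      linarith
    | succ t ih =>
      have hr := hrec t
      push_cast
      rw [show (t : ℝ) + 1 + 2 = ((t : ℝ) + 2) + 1 by ring]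
      have hs : (2 : ℝ) ≤ (t : ℝ) + 2 := by
        have : (0 : ℝ) ≤ t := Nat.cast_nonneg t
        linarith
      generalize (t : ℝ) + 2 = s at *
      have hs0 : 0 < s := by linarith
      have hq : 0 ≤ 1 - (3 / 2) / s := by
        rw [sub_nonneg, div_le_one hs0]; linarith
      have h1 := mul_le_mul_of_nonneg_left ih hq
      have hbern : 1 - (3 / 2) / s ≤ (s / (s + 1)) ^ (3 / 2 : ℝ) := by
        have hb := one_add_mul_self_le_rpow_one_add (s := -(1 / (s + 1))) (p := 3 / 2)
          (by
            rw [neg_le_neg_iff, div_le_one (by linarith)]; linarith) (by norm_num)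
        have e : 1 + -(1 / (s + 1)) = s / (s + 1) := by field_simp; ring
        rw [e] at hb
        have : (3 / 2) / (s + 1) ≤ (3 / 2) / s := by gcongr; linarith
        have e2 : 3 / 2 * -(1 / (s + 1)) = -((3 / 2) / (s + 1)) := by ring
        linarith
      have hpow : (1 - (3 / 2) / s) * (2 / s) ^ (3 / 2 : ℝ) ≤ (2 / (s + 1)) ^ (3 / 2 : ℝ) := by
        have e : 2 / (s + 1) = (s / (s + 1)) * (2 / s) := by field_simp
        rw [e, Real.mul_rpow (by positivity) (by positivity)]
        gcongr
      have h2 := mul_le_mul_of_nonneg_left hpow (ha 0)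
      have hn : σ2 * ((9 / 4) / (A * s * (A * s + B))) ≤ 9 * σ2 / A ^ 2 * (1 / (4 * s ^ 2)) := by
        have e : 9 * σ2 / A ^ 2 * (1 / (4 * s ^ 2)) = σ2 * ((9 / 4) / (A * s * (A * s))) := by
          field_simp
        rw [e]
        gcongr
        linarith
      have hc : 0 ≤ 9 * σ2 / A ^ 2 := by positivity
      generalize 9 * σ2 / A ^ 2 = c at *
      have hfrac : (1 - (3 / 2) / s) * (1 / s) + 1 / (4 * s ^ 2) ≤ 1 / (s + 1) := by
        have e : (1 - (3 / 2) / s) * (1 / s) + 1 / (4 * s ^ 2) = (s - 5 / 4) / s ^ 2 := by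
          field_simp; ring
        rw [e, div_le_div_iff₀ (by positivity) (by positivity)]
        nlinarith
      have h3 := mul_le_mul_of_nonneg_left hfrac hc
      have e1 : c / s = c * (1 / s) := by ring
      have e2 : c / (s + 1) = c * (1 / (s + 1)) := by ring
      rw [e1] at h1
      rw [e2]
      nlinarith
  intro t
  have h := key (t + 1)
  push_cast at h
  rw [show (t : ℝ) + 1 + 2 = (t : ℝ) + 3 by ring, div_div] at h
  exact h
end
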